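/- Let η ≥ 1000 and 0 < c < 0.001, and let k be an integer with (π·cη)^{1/3} ≤ k ≤ (8000·cη·π)^{1/3}. Then every solution (θ, G) of the wave perturbation system with finite X-norms satisfies, for all t with t_k ≤ t ≤ t_{k−1}: ‖θ(t)‖_X + ‖G(t)‖_X ≤ e^{3π}·(‖θ(t_k)‖_X + ‖G(t_k)‖_X). In particular, if k₀ is the largest integer ≤ (π·cη)^{1/3} and k₁ the smallest integer ≥ (8000·cη·π)^{1/3} (both in the admissible range), then ‖θ(t_{k₀})‖_X + ‖G(t_{k₀})‖_X ≤ e^{60π·(cη)^{1/3}}·(‖θ(t_{k₁})‖_X + ‖G(t_{k₁})‖_X). -/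

import Mathlib

noncomputable section

open Real MeasureTheory intervalIntegral

/-- The resonant times: `t_k = (1/2)(η/(k+1) + η/k)` for `k ≥ 1` and `t_0 = 2η`. -/
def tRes (η : ℝ) (k : ℤ) : ℝ :=
  if k = 0 then 2 * η else (η / ((k : ℝ) + 1) + η / (k : ℝ)) / 2

/-- The coefficient `c_l^+(t) = cη(l+1)⁻³(1+(η/(l+1)−t)²)⁻²` (zero if `l+1 = 0`). -/
def cP (c η : ℝ) (l : ℤ) (t : ℝ) : ℝ :=
  if l + 1 = 0 then 0
  else c * η / ((l : ℝ) + 1) ^ 3 * ((1 + (η / ((l : ℝ) + 1) - t) ^ 2) ^ 2)⁻¹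

/-- The coefficient `c_l^−(t) = cη(l−1)⁻³(1+(η/(l−1)−t)²)⁻²` (zero if `l−1 = 0`). -/
def cM (c η : ℝ) (l : ℤ) (t : ℝ) : ℝ :=
  if l - 1 = 0 then 0
  else c * η / ((l : ℝ) - 1) ^ 3 * ((1 + (η / ((l : ℝ) - 1) - t) ^ 2) ^ 2)⁻¹

/-- The coefficient `d_l^+(t) = cη(l+1)⁻³(1+(η/(l+1)−t)²)⁻¹` (zero if `l+1 = 0`). -/
def dP (c η : ℝ) (l : ℤ) (t : ℝ) : ℝ :=
  if l + 1 = 0 then 0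
  else c * η / ((l : ℝ) + 1) ^ 3 * (1 + (η / ((l : ℝ) + 1) - t) ^ 2)⁻¹

/-- The coefficient `d_l^−(t) = cη(l−1)⁻³(1+(η/(l−1)−t)²)⁻¹` (zero if `l−1 = 0`). -/
def dM (c η : ℝ) (l : ℤ) (t : ℝ) : ℝ :=
  if l - 1 = 0 then 0
  else c * η / ((l : ℝ) - 1) ^ 3 * (1 + (η / ((l : ℝ) - 1) - t) ^ 2)⁻¹

/-- Right-hand side of the `θ` equation:
`θ_l′ = c_l⁺θ_{l+1} + c_l⁻θ_{l−1} + d_l⁺G_{l+1} + d_l⁻G_{l−1}`. -/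
def thetaRHS (c η : ℝ) (θ G : ℝ → ℤ → ℂ) (l : ℤ) (t : ℝ) : ℂ :=
  (cP c η l t : ℂ) * θ t (l + 1) + (cM c η l t : ℂ) * θ t (l - 1)
    + (dP c η l t : ℂ) * G t (l + 1) + (dM c η l t : ℂ) * G t (l - 1)

/-- Right-hand side of the `G` equation. -/
def GRHS (ν c η : ℝ) (f : ℝ → ℝ) (θ G : ℝ → ℤ → ℂ) (l : ℤ) (t : ℝ) : ℂ :=
  -((ν * ((l : ℝ) ^ 2 + (η - (l : ℝ) * t) ^ 2) : ℝ) : ℂ) * G t l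
    + (f t : ℂ) * (Complex.I * (l : ℂ) / ((2 * c : ℝ) : ℂ)) *
        ((dP c η l t : ℂ) * G t (l + 1) + (dM c η l t : ℂ) * G t (l - 1)
          + (cP c η l t : ℂ) * θ t (l + 1) + (cM c η l t : ℂ) * θ t (l - 1))
    + ((2 * (η / (l : ℝ) - t) * ((1 + (η / (l : ℝ) - t) ^ 2) ^ 2)⁻¹ : ℝ) : ℂ) * θ t l
    + (((1 + (η / (l : ℝ) - t) ^ 2)⁻¹ : ℝ) : ℂ) *
        ((cP c η l t : ℂ) * θ t (l + 1) + (cM c η l t : ℂ) * θ t (l - 1)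
          + (dP c η l t : ℂ) * G t (l + 1) + (dM c η l t : ℂ) * G t (l - 1))

/-- `(θ, G)` is a solution of the wave perturbation system: zero `x`-average modes, and
each nonzero mode satisfies the coupled ODE system. -/
def IsWaveSol (ν c η : ℝ) (f : ℝ → ℝ) (θ G : ℝ → ℤ → ℂ) : Prop :=
  (∀ t, θ t 0 = 0) ∧ (∀ t, G t 0 = 0) ∧
    ∀ l : ℤ, l ≠ 0 → ∀ t : ℝ,
      HasDerivAt (fun s => θ s l) (thetaRHS c η θ G l t) t ∧
      HasDerivAt (fun s => G s l) (GRHS ν c η f θ G l t) t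

/-- The weighted `ℓ²`-norm `‖u‖_X = (∑ λ(l)²|u_l|²)^{1/2}`. -/
def Xnorm (lam : ℤ → ℝ) (u : ℤ → ℂ) : ℝ :=
  Real.sqrt (∑' l : ℤ, (lam l) ^ 2 * ‖u l‖ ^ 2)

/-- Admissible weight: positive with `λ(l±1) < 2λ(l)`. -/
def GoodWeight (lam : ℤ → ℝ) : Prop :=
  (∀ l, 0 < lam l) ∧ (∀ l, lam (l + 1) < 2 * lam l) ∧ (∀ l, lam (l - 1) < 2 * lam l)

/-- The common majorant of the transport coefficients with source mode `m`. -/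
def sourceCoef (c η : ℝ) (m : ℤ) (t : ℝ) : ℝ :=
  if m = 0 then 0 else |c * η / (m : ℝ) ^ 3| * (1 + (η / (m : ℝ) - t) ^ 2)⁻¹

lemma sourceCoef_nonneg (c η : ℝ) (m : ℤ) (t : ℝ) : 0 ≤ sourceCoef c η m t := by
  unfold sourceCoef
  split_ifs <;> positivity

lemma inv_sq_one_add_sq_le (s : ℝ) : ((1 + s ^ 2) ^ 2)⁻¹ ≤ (1 + s ^ 2)⁻¹ := by
  apply inv_anti₀ (by positivity)
  nlinarith [sq_nonneg s]

lemma abs_dP_le (c η : ℝ) (l : ℤ) (t : ℝ) : |dP c η l t| ≤ sourceCoef c η (l + 1) t := by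
  unfold dP sourceCoef
  split_ifs
  · simp
  · push_cast
    rw [abs_mul, abs_of_nonneg (a := (_ : ℝ)⁻¹) (by positivity)]

lemma abs_dM_le (c η : ℝ) (l : ℤ) (t : ℝ) : |dM c η l t| ≤ sourceCoef c η (l - 1) t := by
  unfold dM sourceCoef
  split_ifs
  · simp
  · push_cast
    rw [abs_mul, abs_of_nonneg (a := (_ : ℝ)⁻¹) (by positivity)]

lemma abs_cP_le (c η : ℝ) (l : ℤ) (t : ℝ) : |cP c η l t| ≤ sourceCoef c η (l + 1) t := by
  unfold cP sourceCoef
  split_ifs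
  · simp
  · push_cast
    rw [abs_mul, abs_of_nonneg (a := (_ : ℝ)⁻¹) (by positivity)]
    exact mul_le_mul_of_nonneg_left (inv_sq_one_add_sq_le _) (abs_nonneg _)

lemma abs_cM_le (c η : ℝ) (l : ℤ) (t : ℝ) : |cM c η l t| ≤ sourceCoef c η (l - 1) t := by
  unfold cM sourceCoef
  split_ifs
  · simp
  · push_cast
    rw [abs_mul, abs_of_nonneg (a := (_ : ℝ)⁻¹) (by positivity)]
    exact mul_le_mul_of_nonneg_left (inv_sq_one_add_sq_le _) (abs_nonneg _)

lemma norm_thetaRHS_le (c η : ℝ) (θ G : ℝ → ℤ → ℂ) (l : ℤ) (t : ℝ) :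
    ‖thetaRHS c η θ G l t‖ ≤
      sourceCoef c η (l + 1) t * (‖θ t (l + 1)‖ + ‖G t (l + 1)‖)
        + sourceCoef c η (l - 1) t * (‖θ t (l - 1)‖ + ‖G t (l - 1)‖) := by
  have key : ∀ (a b : ℝ) (z : ℂ), |a| ≤ b → ‖(a : ℂ) * z‖ ≤ b * ‖z‖ := by
    intro a b z h
    rw [norm_mul, Complex.norm_real, Real.norm_eq_abs]
    exact mul_le_mul_of_nonneg_right h (norm_nonneg _)
  unfold thetaRHS
  refine (norm_add_le _ _).trans ?_
  have h1 := norm_add₃_le (a := (cP c η l t : ℂ) * θ t (l + 1))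
    (b := (cM c η l t : ℂ) * θ t (l - 1)) (c := (dP c η l t : ℂ) * G t (l + 1))
  have h2 := key _ _ (θ t (l + 1)) (abs_cP_le c η l t)
  have h3 := key _ _ (θ t (l - 1)) (abs_cM_le c η l t)
  have h4 := key _ _ (G t (l + 1)) (abs_dP_le c η l t)
  have h5 := key _ _ (G t (l - 1)) (abs_dM_le c η l t)
  linarith

lemma GRHS_eq (ν c η : ℝ) (f : ℝ → ℝ) (θ G : ℝ → ℤ → ℂ) (l : ℤ) (t : ℝ) :
    GRHS ν c η f θ G l t =
      (-(ν * ((l : ℝ) ^ 2 + (η - (l : ℝ) * t) ^ 2))) • G t l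
        + ((f t : ℂ) * (Complex.I * (l : ℂ) / ((2 * c : ℝ) : ℂ)) * thetaRHS c η θ G l t
        + (((2 * (η / (l : ℝ) - t) * ((1 + (η / (l : ℝ) - t) ^ 2) ^ 2)⁻¹ : ℝ) : ℂ) * θ t l
        + (((1 + (η / (l : ℝ) - t) ^ 2)⁻¹ : ℝ) : ℂ) * thetaRHS c η θ G l t)) := by
  unfold GRHS thetaRHS
  rw [Complex.real_smul]
  push_cast
  ring

lemma inner_GRHS_le {ν c η : ℝ} (hν : 0 < ν) (hc : 0 < c) (f : ℝ → ℝ) (θ G : ℝ → ℤ → ℂ)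
    (l : ℤ) (t : ℝ) :
    inner ℝ (G t l) (GRHS ν c η f θ G l t) ≤
      ‖G t l‖ * ((|f t| * |(l : ℝ)| / (2 * c) + 1) * ‖thetaRHS c η θ G l t‖)
        + 2 * |η / (l : ℝ) - t| * ((1 + (η / (l : ℝ) - t) ^ 2) ^ 2)⁻¹ * (‖θ t l‖ * ‖G t l‖) := by
  rw [GRHS_eq, inner_add_right, inner_smul_right]
  have h0 : -(ν * ((l : ℝ) ^ 2 + (η - (l : ℝ) * t) ^ 2)) * inner ℝ (G t l) (G t l) ≤ 0 := by
    rw [real_inner_self_eq_norm_sq]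
    have : 0 ≤ ν * ((l : ℝ) ^ 2 + (η - (l : ℝ) * t) ^ 2) * ‖G t l‖ ^ 2 := by positivity
    linarith
  refine (add_le_add h0 (real_inner_le_norm _ _)).trans ?_
  rw [zero_add]
  have h1 : ‖(f t : ℂ) * (Complex.I * (l : ℂ) / ((2 * c : ℝ) : ℂ)) * thetaRHS c η θ G l t‖
      = |f t| * |(l : ℝ)| / (2 * c) * ‖thetaRHS c η θ G l t‖ := by
    rw [norm_mul, norm_mul, norm_div, norm_mul, Complex.norm_I, Complex.norm_real,
      Complex.norm_real, Real.norm_eq_abs, Real.norm_eq_abs, abs_of_pos (a := 2 * c) (by positivity),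
      Complex.norm_intCast]
    ring
  have h2 : ‖(((2 * (η / (l : ℝ) - t) * ((1 + (η / (l : ℝ) - t) ^ 2) ^ 2)⁻¹ : ℝ) : ℂ)) * θ t l‖
      = 2 * |η / (l : ℝ) - t| * ((1 + (η / (l : ℝ) - t) ^ 2) ^ 2)⁻¹ * ‖θ t l‖ := by
    rw [norm_mul, Complex.norm_real, Real.norm_eq_abs, abs_mul, abs_mul,
      abs_of_nonneg (a := (_ : ℝ)⁻¹) (by positivity), abs_two]
  have h3 : ‖(((1 + (η / (l : ℝ) - t) ^ 2)⁻¹ : ℝ) : ℂ) * thetaRHS c η θ G l t‖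
      ≤ 1 * ‖thetaRHS c η θ G l t‖ := by
    rw [norm_mul, Complex.norm_real, Real.norm_eq_abs, abs_of_nonneg (by positivity)]
    refine mul_le_mul_of_nonneg_right (inv_le_one_of_one_le₀ ?_) (norm_nonneg _)
    nlinarith [sq_nonneg (η / (l : ℝ) - t)]
  have h4 := norm_add₃_le
    (a := (f t : ℂ) * (Complex.I * (l : ℂ) / ((2 * c : ℝ) : ℂ)) * thetaRHS c η θ G l t)
    (b := (((2 * (η / (l : ℝ) - t) * ((1 + (η / (l : ℝ) - t) ^ 2) ^ 2)⁻¹ : ℝ) : ℂ)) * θ t l)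
    (c := (((1 + (η / (l : ℝ) - t) ^ 2)⁻¹ : ℝ) : ℂ) * thetaRHS c η θ G l t)
  rw [h1, h2] at h4
  rw [← add_assoc]
  refine (mul_le_mul_of_nonneg_left (h4.trans (add_le_add_right h3 _)) (norm_nonneg _)).trans ?_
  apply le_of_eq
  ring

lemma tRes_of_pos (η : ℝ) {k : ℤ} (hk : 1 ≤ k) :
    tRes η k = (η / ((k : ℝ) + 1) + η / (k : ℝ)) / 2 := by
  unfold tRes
  rw [if_neg (by omega)]

lemma tRes_pred (η : ℝ) {k : ℤ} (hk : 2 ≤ k) :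
    tRes η (k - 1) = (η / (k : ℝ) + η / ((k : ℝ) - 1)) / 2 := by
  rw [tRes_of_pos η (by omega)]
  push_cast
  ring_nf

lemma div_succ_le_tRes {η : ℝ} (hη : 0 < η) {k : ℤ} (hk : 1 ≤ k) :
    η / ((k : ℝ) + 1) ≤ tRes η k := by
  have hk' : (1 : ℝ) ≤ k := by exact_mod_cast hk
  rw [tRes_of_pos η hk]
  have : η / ((k : ℝ) + 1) ≤ η / k := by gcongr; linarith
  linarith

lemma tRes_le_pred {η : ℝ} (hη : 0 < η) {k : ℤ} (hk : 2 ≤ k) : tRes η k ≤ tRes η (k - 1) := by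
  have hk' : (2 : ℝ) ≤ k := by exact_mod_cast hk
  rw [tRes_of_pos η (by omega), tRes_pred η hk]
  have h1 : η / ((k : ℝ) + 1) ≤ η / k := by gcongr; linarith
  have h2 : η / (k : ℝ) ≤ η / ((k : ℝ) - 1) := by
    gcongr
    · linarith
    · linarith
  linarith

/-- Away from resonance the detuning is bounded below, uniformly and relative to the mode. -/
lemma detuning_ge {η : ℝ} (hη : 0 < η) {k : ℤ} (hk : 1 ≤ k) {t : ℝ} (h1 : tRes η k ≤ t)
    (h2 : t ≤ tRes η (k - 1)) {l : ℤ} (hl0 : l ≠ 0) (hlk : l ≠ k) :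
    η / (2 * k * (k + 1)) ≤ |η / (l : ℝ) - t| ∧ η / (2 * k * |(l : ℝ)|) ≤ |η / (l : ℝ) - t| := by
  have hk' : (1 : ℝ) ≤ k := by exact_mod_cast hk
  have hk0 : (0 : ℝ) < k := by linarith
  rcases lt_or_gt_of_ne hlk with h | h
  · rcases lt_or_gt_of_ne hl0 with hn | hp
    · have hl : (l : ℝ) < 0 := by exact_mod_cast hn
      have h3 := div_succ_le_tRes hη hk
      have h4 : η / (l : ℝ) ≤ 0 := div_nonpos_of_nonneg_of_nonpos hη.le hl.le
      have h5 : 0 ≤ η / ((k : ℝ) + 1) := by positivity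
      rw [abs_of_nonpos (by linarith), abs_of_neg hl]
      constructor
      · have : η / (2 * k * (k + 1)) ≤ η / ((k : ℝ) + 1) := by
          gcongr
          nlinarith
        linarith
      · have : η / (2 * k * -(l : ℝ)) ≤ η / (-(l : ℝ)) := by
          have : 0 < -(l : ℝ) := by linarith
          gcongr
          nlinarith
        rw [div_neg] at this
        linarith
    · have hl : (1 : ℝ) ≤ l := by exact_mod_cast hp
      have hlk' : (l : ℝ) ≤ k - 1 := by
        have : l ≤ k - 1 := by omega
        exact_mod_cast this
      have hk1 : (0 : ℝ) < k - 1 := by linarith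
      rw [tRes_pred η (by omega)] at h2
      have h3 : η / ((k : ℝ) - 1) ≤ η / l := by gcongr
      have h4 : η / (k : ℝ) + η / (k * (k - 1)) = η / ((k : ℝ) - 1) := by
        field_simp
        ring
      have h5 : 0 < η / (k * (k - 1) : ℝ) := by positivity
      rw [abs_of_nonneg (by linarith), abs_of_pos (by linarith)]
      constructor
      · have : η / (2 * k * (k + 1)) ≤ η / (k * (k - 1)) / 2 := by
          rw [div_div]
          refine div_le_div_of_nonneg_left hη.le (by positivity) ?_
          nlinarith
        linarith
      · have : η / (k : ℝ) + η * (k - l) / (k * l) = η / l := by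
          field_simp
          ring
        have h6 : η / (2 * k * l) ≤ η * (k - l) / (k * l) / 2 := by
          rw [div_div, show (2 * k * l : ℝ) = k * l * 2 by ring]
          gcongr
          nlinarith
        linarith
  · have hlk' : (k : ℝ) + 1 ≤ l := by exact_mod_cast h
    rw [tRes_of_pos η hk] at h1
    have h3 : η / (l : ℝ) ≤ η / ((k : ℝ) + 1) := by gcongr
    have h4 : η / ((k : ℝ) + 1) + η / (k * (k + 1)) = η / (k : ℝ) := by
      field_simp
    have h5 : 0 < η / (k * (k + 1) : ℝ) := by positivity
    rw [abs_of_nonpos (by linarith), abs_of_pos (by linarith)]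
    constructor
    · have : η / (2 * k * (k + 1)) = η / (k * (k + 1)) / 2 := by
        field_simp
      linarith
    · have hl : (0 : ℝ) < l := by linarith
      have : η / (l : ℝ) + η * (l - k) / (k * l) = η / k := by
        field_simp
        ring
      have h6 : η / (2 * k * l) ≤ η * (l - k) / (k * l) / 2 := by
        rw [div_div, show (2 * k * l : ℝ) = k * l * 2 by ring]
        gcongr
        nlinarith
      linarith

lemma resonant_interval_length {η : ℝ} (hη : 0 < η) {k : ℤ} (hk : 1 ≤ k) :
    k * (k + 1) / η * (tRes η (k - 1) - tRes η k) ≤ 5 / 2 ∧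
      k ^ 2 / η * (tRes η (k - 1) - tRes η k) ≤ 4 / 3 := by
  rcases hk.eq_or_lt with rfl | h
  · rw [tRes_of_pos η le_rfl]
    simp only [tRes]
    push_cast
    constructor <;> (norm_num; field_simp; norm_num)
  · have h2 : 2 ≤ k := h
    have hk' : (2 : ℝ) ≤ k := by exact_mod_cast h2
    rw [tRes_of_pos η hk, tRes_pred η h2]
    have hk1 : (0 : ℝ) < k - 1 := by linarith
    have e : (η / (k : ℝ) + η / (k - 1)) / 2 - (η / ((k : ℝ) + 1) + η / k) / 2
        = η / ((k - 1) * (k + 1)) := by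
      field_simp
      ring
    rw [e]
    constructor
    · have : (k : ℝ) * (k + 1) / η * (η / ((k - 1) * (k + 1))) = k / (k - 1) := by
        field_simp
      rw [this, div_le_div_iff₀ hk1 (by norm_num)]
      linarith
    · have : (k : ℝ) ^ 2 / η * (η / ((k - 1) * (k + 1))) = k ^ 2 / ((k - 1) * (k + 1)) := by
        field_simp
      rw [this, div_le_div_iff₀ (by positivity) (by norm_num)]
      nlinarith

lemma two_mul_abs_mul_inv_sq_le {s : ℝ} (hs : s ≠ 0) :
    2 * |s| * ((1 + s ^ 2) ^ 2)⁻¹ ≤ (2 * |s|)⁻¹ := by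
  have hs' : 0 < |s| := abs_pos.mpr hs
  rw [← div_eq_mul_inv, inv_eq_one_div, div_le_div_iff₀ (by positivity) (by positivity)]
  nlinarith [sq_abs s, sq_nonneg (1 - s ^ 2)]

lemma detuned_coupling_le {η : ℝ} (hη : 0 < η) {k : ℤ} (hk : 1 ≤ k) {t : ℝ}
    (h1 : tRes η k ≤ t) (h2 : t ≤ tRes η (k - 1)) {l : ℤ} (hl0 : l ≠ 0) :
    2 * |η / (l : ℝ) - t| * ((1 + (η / (l : ℝ) - t) ^ 2) ^ 2)⁻¹ ≤
      2 * |t - η / (k : ℝ)| / (1 + (t - η / (k : ℝ)) ^ 2) ^ 2 + k * (k + 1) / η := by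
  have hk' : (1 : ℝ) ≤ k := by exact_mod_cast hk
  have hpos : 0 < η / (2 * k * (k + 1) : ℝ) := by positivity
  by_cases hlk : l = k
  · subst hlk
    rw [abs_sub_comm, sub_sq_comm (η / (l : ℝ)) t, ← div_eq_mul_inv]
    have : 0 ≤ (l : ℝ) * (l + 1) / η := by positivity
    linarith
  · have h3 := (detuning_ge hη hk h1 h2 hl0 hlk).1
    have hne : η / (l : ℝ) - t ≠ 0 := abs_pos.mp (hpos.trans_le h3)
    refine (two_mul_abs_mul_inv_sq_le hne).trans ?_
    have : (2 * |η / (l : ℝ) - t|)⁻¹ ≤ (2 * (η / (2 * k * (k + 1))))⁻¹ := by gcongr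
    have e : (2 * (η / (2 * k * (k + 1) : ℝ)))⁻¹ = k * (k + 1) / η := by
      field_simp
    rw [e] at this
    have : 0 ≤ 2 * |t - η / (k : ℝ)| / (1 + (t - η / (k : ℝ)) ^ 2) ^ 2 := by positivity
    linarith

lemma sourceCoef_le {c η : ℝ} (hc : 0 < c) (hη : 0 < η) {k : ℤ} (hk : 1 ≤ k) {t : ℝ}
    (h1 : tRes η k ≤ t) (h2 : t ≤ tRes η (k - 1)) (m : ℤ) :
    sourceCoef c η m t ≤ 4 * c * k ^ 2 / η +
      if m = k then c * η / (k : ℝ) ^ 3 / (1 + (t - η / (k : ℝ)) ^ 2) else 0 := by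
  have hk' : (1 : ℝ) ≤ k := by exact_mod_cast hk
  have h0 : 0 ≤ 4 * c * (k : ℝ) ^ 2 / η := by positivity
  unfold sourceCoef
  by_cases hm : m = 0
  · rw [if_pos hm, if_neg (by omega)]
    linarith
  by_cases hmk : m = k
  · subst hmk
    rw [if_neg hm, if_pos rfl, abs_of_pos (by positivity), ← sub_sq_comm t, div_eq_mul_inv _ (1 + _)]
    linarith
  · rw [if_neg hm, if_neg hmk, add_zero]
    have h3 := (detuning_ge hη hk h1 h2 hm hmk).2
    have hM : (1 : ℝ) ≤ |(m : ℝ)| := by exact_mod_cast Int.one_le_abs hm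
    have h4 : (η / (2 * k * |(m : ℝ)|)) ^ 2 ≤ 1 + (η / (m : ℝ) - t) ^ 2 := by
      rw [← sq_abs (η / (m : ℝ) - t)]
      have := pow_le_pow_left₀ (by positivity) h3 2
      linarith
    rw [abs_div, abs_pow, abs_of_pos (a := c * η) (by positivity)]
    set M := |(m : ℝ)|
    calc c * η / M ^ 3 * (1 + (η / (m : ℝ) - t) ^ 2)⁻¹
        ≤ c * η / M ^ 3 * ((η / (2 * k * M)) ^ 2)⁻¹ := by gcongr
      _ = 4 * c * k ^ 2 / η * (1 / M) := by
        field_simp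
        norm_num
      _ ≤ 4 * c * k ^ 2 / η * 1 := by
        gcongr
        rw [div_le_one (by linarith)]
        exact hM
      _ = _ := mul_one _

/-- The background shear contributes a coupling of the same size as the detuned modes. -/
lemma shear_mul_sourceCoef_le {c η : ℝ} (hc : 0 < c) (hη : 0 < η) {k : ℤ} (hk : 1 ≤ k) {t : ℝ}
    (h1 : tRes η k ≤ t) {y : ℝ} (hy : |y| ≤ 4 * c / (1 + t ^ 2)) {l m : ℤ}
    (hlm : |l| ≤ |m| + 1) :
    |y| * |(l : ℝ)| / (2 * c) * sourceCoef c η m t ≤ 16 * c * k ^ 2 / η := by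
  have hk' : (1 : ℝ) ≤ k := by exact_mod_cast hk
  unfold sourceCoef
  split_ifs with hm
  · rw [mul_zero]
    positivity
  have hM : (1 : ℝ) ≤ |(m : ℝ)| := by exact_mod_cast Int.one_le_abs hm
  have hL : |(l : ℝ)| ≤ 2 * |(m : ℝ)| := by
    have : |(l : ℝ)| ≤ |(m : ℝ)| + 1 := by exact_mod_cast hlm
    linarith
  have ht : η / (2 * k) ≤ t := by
    refine le_trans ?_ ((div_succ_le_tRes hη hk).trans h1)
    gcongr
    linarith
  have ht2 : (η / (2 * k)) ^ 2 ≤ 1 + t ^ 2 := by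
    have := pow_le_pow_left₀ (by positivity) ht 2
    linarith
  have hinv : (1 + (η / (m : ℝ) - t) ^ 2)⁻¹ ≤ 1 := by
    apply inv_le_one_of_one_le₀
    nlinarith [sq_nonneg (η / (m : ℝ) - t)]
  rw [abs_div, abs_pow, abs_of_pos (a := c * η) (by positivity)]
  set M := |(m : ℝ)|
  calc |y| * |(l : ℝ)| / (2 * c) * (c * η / M ^ 3 * (1 + (η / (m : ℝ) - t) ^ 2)⁻¹)
      ≤ 4 * c / (η / (2 * k)) ^ 2 * (2 * M) / (2 * c) * (c * η / M ^ 3 * 1) := by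
        gcongr
        exact hy.trans (by gcongr)
    _ = 16 * c * k ^ 2 / η * (1 / M ^ 2) := by
        field_simp
        norm_num
    _ ≤ 16 * c * k ^ 2 / η * 1 := by
        gcongr
        rw [div_le_one (by positivity)]
        exact one_le_pow₀ hM
    _ = _ := mul_one _

lemma tsum_le_of_le_of_nonneg {ι : Type*} {a b : ι → ℝ} (hab : ∀ i, a i ≤ b i)
    (hb0 : ∀ i, 0 ≤ b i) (hb : Summable b) : ∑' i, a i ≤ ∑' i, b i := by
  by_cases ha : Summable a
  · exact ha.tsum_le_tsum hab hb
  · rw [tsum_eq_zero_of_not_summable ha]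
    exact tsum_nonneg hb0

lemma hasSum_int_shift {u : ℤ → ℝ} {S : ℝ} (h : HasSum u S) (n : ℤ) :
    HasSum (fun l => u (l + n)) S :=
  (Equiv.addRight n).hasSum_iff.mpr h

/-- A nearest-neighbour quadratic form whose coefficient is `ε`, except for an extra `δ` at the
single source mode `k`. -/
lemma neighbour_form_le {v e : ℤ → ℝ} (hv : ∀ l, v l ^ 2 ≤ 2 * e l)
    {ε δ : ℝ} (hε : 0 ≤ ε) (hδ : 0 ≤ δ) (k l : ℤ) :
    4 * v l * ((ε + if l + 1 = k then δ else 0) * v (l + 1)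
        + (ε + if l - 1 = k then δ else 0) * v (l - 1)) ≤
      4 * ε * (2 * e l + e (l + 1) + e (l - 1))
        + 4 * δ * (3 / 4 * ((if l + 1 = k then e (l + 1) else 0)
          + (if l - 1 = k then e (l - 1) else 0)) + 3 / 2 * (e l - if l = k then e l else 0)) := by
  have he : ∀ l, 0 ≤ e l := fun l => by nlinarith [hv l, sq_nonneg (v l)]
  have h1 : 4 * ε * (v l * v (l + 1) + v l * v (l - 1))
      ≤ 4 * ε * (2 * e l + e (l + 1) + e (l - 1)) := by
    refine mul_le_mul_of_nonneg_left ?_ (by positivity)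
    nlinarith [hv l, hv (l + 1), hv (l - 1), sq_nonneg (v l - v (l + 1)),
      sq_nonneg (v l - v (l - 1))]
  have key : ∀ m, 4 * δ * (v l * v m) ≤ 4 * δ * (3 / 4 * e m + 3 / 2 * e l) := by
    intro m
    gcongr
    nlinarith [hv l, hv m, sq_nonneg (4 * v l - 3 * v m), he l]
  by_cases ha : l + 1 = k
  · have hb : ¬ l - 1 = k := by omega
    have hc : ¬ l = k := by omega
    simp only [ha, hb, hc, if_true, if_false]
    have := key k
    rw [ha] at h1
    linarith
  · by_cases hb : l - 1 = k
    · have hc : ¬ l = k := by omega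
      simp only [ha, hb, hc, if_true, if_false]
      have := key k
      rw [hb] at h1
      linarith
    · simp only [ha, hb, if_false]
      have : 0 ≤ 4 * δ * (3 / 2 * (e l - if l = k then e l else 0)) := by
        have : 0 ≤ e l - if l = k then e l else 0 := by
          split_ifs
          · simp
          · simpa using he l
        positivity
      linarith

lemma hasSum_neighbour_majorant {e : ℤ → ℝ} {E : ℝ} (h : HasSum e E) (he : ∀ l, 0 ≤ e l)
    (ε δ γ : ℝ) (k : ℤ) :
    HasSum (fun l => 4 * ε * (2 * e l + e (l + 1) + e (l - 1))
        + 4 * δ * (3 / 4 * ((if l + 1 = k then e (l + 1) else 0)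
          + (if l - 1 = k then e (l - 1) else 0)) + 3 / 2 * (e l - if l = k then e l else 0))
        + γ * e l) ((16 * ε + 6 * δ + γ) * E) := by
  obtain ⟨R, hR⟩ : Summable (fun l => if l = k then e l else 0) := by
    refine Summable.of_nonneg_of_le (fun l => ?_) (fun l => ?_) h.summable
    · split_ifs
      · exact he l
      · exact le_rfl
    · split_ifs
      · exact le_rfl
      · exact he l
  have e1 := hasSum_int_shift h 1
  have e2 := hasSum_int_shift h (-1)
  have r1 := hasSum_int_shift hR 1
  have r2 := hasSum_int_shift hR (-1)
  simp only [← sub_eq_add_neg] at e2 r2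
  have := ((((h.mul_left 2).add e1).add e2).mul_left (4 * ε)).add
    (((((r1.add r2).mul_left (3 / 4)).add ((h.sub hR).mul_left (3 / 2))).mul_left (4 * δ)))
  have hE : (16 * ε + 6 * δ + γ) * E = 4 * ε * (2 * E + E + E)
      + 4 * δ * (3 / 4 * (R + R) + 3 / 2 * (E - R)) + γ * E := by ring
  rw [hE]
  exact this.add (h.mul_left γ)

lemma le_exp_sub_mul_of_deriv_le {E E' Φ Φ' : ℝ → ℝ} {a b : ℝ} (hab : a ≤ b)
    (hE : ∀ t, HasDerivAt E (E' t) t) (hΦ : ∀ t, HasDerivAt Φ (Φ' t) t)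
    (h : ∀ t ∈ Set.Icc a b, E' t ≤ Φ' t * E t) : E b ≤ Real.exp (Φ b - Φ a) * E a := by
  have hF : ∀ t, HasDerivAt (fun t => E t * Real.exp (-Φ t))
      (E' t * Real.exp (-Φ t) + E t * (Real.exp (-Φ t) * -Φ' t)) t := fun t =>
    (hE t).mul (hΦ t).neg.exp
  have hanti : AntitoneOn (fun t => E t * Real.exp (-Φ t)) (Set.Icc a b) := by
    apply antitoneOn_of_deriv_nonpos (convex_Icc a b)
    · exact fun t _ => (hF t).continuousAt.continuousWithinAt
    · exact fun t _ => (hF t).differentiableAt.differentiableWithinAt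
    · intro t ht
      rw [(hF t).deriv]
      have h1 := h t (interior_subset ht)
      nlinarith [Real.exp_pos (-Φ t)]
  have h2 := hanti (Set.left_mem_Icc.mpr hab) (Set.right_mem_Icc.mpr hab) hab
  simp only at h2
  have h3 := mul_le_mul_of_nonneg_right h2 (Real.exp_pos (Φ b)).le
  rw [mul_assoc, ← Real.exp_add, neg_add_cancel, Real.exp_zero, mul_one, mul_assoc,
    ← Real.exp_add] at h3
  rw [mul_comm (Real.exp _)]
  rwa [neg_add_eq_sub] at h3

lemma hasDerivAt_mul_abs_self (x : ℝ) : HasDerivAt (fun y : ℝ => y * |y|) (2 * |x|) x := by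
  rcases lt_trichotomy x 0 with h | rfl | h
  · refine ((hasDerivAt_id x).mul (hasDerivAt_abs_neg h)).congr_deriv ?_
    rw [abs_of_neg h, id]
    ring
  · rw [hasDerivAt_iff_isLittleO_nhds_zero]
    simp only [zero_add, abs_zero, mul_zero, smul_zero, sub_zero]
    rw [Asymptotics.isLittleO_iff]
    intro c hc
    filter_upwards [Metric.ball_mem_nhds (0 : ℝ) hc] with y hy
    rw [Metric.mem_ball, dist_zero_right, Real.norm_eq_abs] at hy
    rw [norm_mul, Real.norm_eq_abs, Real.norm_eq_abs, abs_abs]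
    exact mul_le_mul_of_nonneg_right hy.le (abs_nonneg _)
  · refine ((hasDerivAt_id x).mul (hasDerivAt_abs_pos h)).congr_deriv ?_
    rw [abs_of_pos h, id]
    ring

lemma hasDerivAt_mul_abs_div (x : ℝ) :
    HasDerivAt (fun y : ℝ => y * |y| / (1 + y ^ 2)) (2 * |x| / (1 + x ^ 2) ^ 2) x := by
  have h0 : 1 + x ^ 2 ≠ 0 := by positivity
  have h1 : HasDerivAt (fun y : ℝ => 1 + y ^ 2) (2 * x) x := by
    simpa using (hasDerivAt_pow 2 x).const_add 1
  refine ((hasDerivAt_mul_abs_self x).div h1 h0).congr_deriv ?_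
  congr 1
  ring

lemma abs_mul_abs_div_le_one (x : ℝ) : |x * |x| / (1 + x ^ 2)| ≤ 1 := by
  rw [abs_div, abs_mul, abs_abs, ← pow_two, sq_abs, abs_of_pos (a := 1 + x ^ 2) (by positivity),
    div_le_one (by positivity)]
  linarith

/-- The energy inequality on the `k`-th resonant interval. -/
lemma energy_deriv_le {ν c η : ℝ} (hν : 0 < ν) (hc : 0 < c) (hη : 0 < η) {f : ℝ → ℝ}
    {θ G : ℝ → ℤ → ℂ} (hsol : IsWaveSol ν c η f θ G) {lam : ℤ → ℝ} (hlam : GoodWeight lam)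
    {k : ℤ} (hk : 1 ≤ k) {t : ℝ} (h1 : tRes η k ≤ t) (h2 : t ≤ tRes η (k - 1))
    (hft : |f t| ≤ 4 * c / (1 + t ^ 2))
    (hθ : Summable fun l : ℤ => lam l ^ 2 * ‖θ t l‖ ^ 2)
    (hG : Summable fun l : ℤ => lam l ^ 2 * ‖G t l‖ ^ 2) :
    (∑' l : ℤ, lam l ^ 2 * deriv (fun s => ‖θ s l‖ ^ 2) t)
        + (∑' l : ℤ, lam l ^ 2 * deriv (fun s => ‖G s l‖ ^ 2) t) ≤
      (16 * (20 * c * k ^ 2 / η)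
          + 6 * (c * η / (k : ℝ) ^ 3 / (1 + (t - η / (k : ℝ)) ^ 2))
          + (2 * |t - η / (k : ℝ)| / (1 + (t - η / (k : ℝ)) ^ 2) ^ 2 + k * (k + 1) / η))
        * ((∑' l : ℤ, lam l ^ 2 * ‖θ t l‖ ^ 2) + ∑' l : ℤ, lam l ^ 2 * ‖G t l‖ ^ 2) := by
  have hk' : (1 : ℝ) ≤ k := by exact_mod_cast hk
  obtain ⟨hθ0, hG0, hode⟩ := hsol
  obtain ⟨lpos, lP, lM⟩ := hlam
  set ε : ℝ := 20 * c * k ^ 2 / η with hε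
  set δ : ℝ := c * η / (k : ℝ) ^ 3 / (1 + (t - η / (k : ℝ)) ^ 2) with hδ
  set γ : ℝ := 2 * |t - η / (k : ℝ)| / (1 + (t - η / (k : ℝ)) ^ 2) ^ 2 + k * (k + 1) / η with hγ
  have hε0 : 0 ≤ ε := by positivity
  have hδ0 : 0 ≤ δ := by positivity
  have hγ0 : 0 ≤ γ := by positivity
  set p : ℤ → ℝ := fun l => lam l * ‖θ t l‖ with hp
  set q : ℤ → ℝ := fun l => lam l * ‖G t l‖ with hq
  have hp0 : ∀ l, 0 ≤ p l := fun l => mul_nonneg (lpos l).le (norm_nonneg _)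
  have hq0 : ∀ l, 0 ≤ q l := fun l => mul_nonneg (lpos l).le (norm_nonneg _)
  set b : ℤ → ℝ := fun m => ε + if m = k then δ else 0 with hb
  have hb0 : ∀ m, 0 ≤ b m := fun m => by
    simp only [hb]
    split_ifs <;> positivity
  set W : ℤ → ℝ := fun l => b (l + 1) * (p (l + 1) + q (l + 1)) + b (l - 1) * (p (l - 1) + q (l - 1))
    with hW
  have hW0 : ∀ l, 0 ≤ W l := fun l =>
    add_nonneg (mul_nonneg (hb0 _) (add_nonneg (hp0 _) (hq0 _)))
      (mul_nonneg (hb0 _) (add_nonneg (hp0 _) (hq0 _)))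
  -- coupling bound for a neighbouring pair of modes
  have hcoef : ∀ l m : ℤ, |l| ≤ |m| + 1 →
      (|f t| * |(l : ℝ)| / (2 * c) + 1) * sourceCoef c η m t ≤ b m := by
    intro l m hlm
    have e1 := sourceCoef_le hc hη hk h1 h2 m
    have e2 := shear_mul_sourceCoef_le hc hη hk h1 hft hlm
    have e3 : 4 * c * k ^ 2 / η + 16 * c * k ^ 2 / η = ε := by
      rw [hε]
      ring
    simp only [hb]
    linarith
  have hRHS : ∀ l : ℤ, lam l * ((|f t| * |(l : ℝ)| / (2 * c) + 1) * ‖thetaRHS c η θ G l t‖)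
      ≤ 2 * W l := by
    intro l
    have hA : 0 ≤ |f t| * |(l : ℝ)| / (2 * c) + 1 := by positivity
    have side : ∀ m : ℤ, |l| ≤ |m| + 1 → lam l ≤ 2 * lam m →
        lam l * ((|f t| * |(l : ℝ)| / (2 * c) + 1) * (sourceCoef c η m t * (‖θ t m‖ + ‖G t m‖)))
          ≤ 2 * (b m * (p m + q m)) := by
      intro m hlm hl
      calc lam l * ((|f t| * |(l : ℝ)| / (2 * c) + 1)
            * (sourceCoef c η m t * (‖θ t m‖ + ‖G t m‖)))
          = lam l * (((|f t| * |(l : ℝ)| / (2 * c) + 1) * sourceCoef c η m t)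
            * (‖θ t m‖ + ‖G t m‖)) := by ring
        _ ≤ (2 * lam m) * (b m * (‖θ t m‖ + ‖G t m‖)) := by
          have hs := sourceCoef_nonneg c η m t
          have := lpos m
          gcongr
          exact hcoef l m hlm
        _ = 2 * (b m * (p m + q m)) := by
          simp only [hp, hq]
          ring
    have sP := side (l + 1) (by simpa using abs_sub (l + 1) 1) (by simpa using (lM (l + 1)).le)
    have sM := side (l - 1) (by simpa using abs_add_le (l - 1) 1) (by simpa using (lP (l - 1)).le)
    have hn := mul_le_mul_of_nonneg_left
      (mul_le_mul_of_nonneg_left (norm_thetaRHS_le c η θ G l t) hA) (lpos l).le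
    simp only [hW]
    linarith
  have hdθ : ∀ l, lam l ^ 2 * deriv (fun s => ‖θ s l‖ ^ 2) t ≤ 4 * p l * W l := by
    intro l
    by_cases hl : l = 0
    · subst hl
      have : (fun s => ‖θ s 0‖ ^ 2) = fun _ => (0 : ℝ) := by
        funext s
        simp [hθ0 s]
      rw [this, deriv_const, mul_zero]
      exact mul_nonneg (mul_nonneg (by norm_num) (hp0 _)) (hW0 _)
    · rw [((hode l hl t).1.norm_sq).deriv]
      have e1 := real_inner_le_norm (θ t l) (thetaRHS c η θ G l t)
      have e2 := hRHS l
      have e3 : lam l * ‖thetaRHS c η θ G l t‖ ≤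
          lam l * ((|f t| * |(l : ℝ)| / (2 * c) + 1) * ‖thetaRHS c η θ G l t‖) := by
        have : 0 ≤ |f t| * |(l : ℝ)| / (2 * c) := by positivity
        have hl0 := (lpos l).le
        gcongr
        exact le_mul_of_one_le_left (norm_nonneg _) (by linarith)
      calc lam l ^ 2 * (2 * inner ℝ (θ t l) (thetaRHS c η θ G l t))
          ≤ lam l ^ 2 * (2 * (‖θ t l‖ * ‖thetaRHS c η θ G l t‖)) := by gcongr
        _ = 2 * p l * (lam l * ‖thetaRHS c η θ G l t‖) := by
          simp only [hp]
          ring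
        _ ≤ 2 * p l * (2 * W l) := by
          have := hp0 l
          exact mul_le_mul_of_nonneg_left (e3.trans e2) (by positivity)
        _ = 4 * p l * W l := by ring
  have hdG : ∀ l, lam l ^ 2 * deriv (fun s => ‖G s l‖ ^ 2) t
      ≤ 4 * q l * W l + γ * (p l ^ 2 + q l ^ 2) := by
    intro l
    by_cases hl : l = 0
    · subst hl
      have : (fun s => ‖G s 0‖ ^ 2) = fun _ => (0 : ℝ) := by
        funext s
        simp [hG0 s]
      rw [this, deriv_const, mul_zero]
      exact add_nonneg (mul_nonneg (mul_nonneg (by norm_num) (hq0 _)) (hW0 _)) (by positivity)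
    · rw [((hode l hl t).2.norm_sq).deriv]
      have e1 := inner_GRHS_le (η := η) hν hc f θ G l t
      have e2 := hRHS l
      have e4 := detuned_coupling_le hη hk h1 h2 hl
      calc lam l ^ 2 * (2 * inner ℝ (G t l) (GRHS ν c η f θ G l t))
          ≤ lam l ^ 2 * (2 * (‖G t l‖
              * ((|f t| * |(l : ℝ)| / (2 * c) + 1) * ‖thetaRHS c η θ G l t‖)
              + γ * (‖θ t l‖ * ‖G t l‖))) := by
            gcongr
            exact e1.trans (by gcongr)
        _ = 2 * q l * (lam l * ((|f t| * |(l : ℝ)| / (2 * c) + 1) * ‖thetaRHS c η θ G l t‖))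
              + γ * (2 * p l * q l) := by
          simp only [hp, hq]
          ring
        _ ≤ 2 * q l * (2 * W l) + γ * (p l ^ 2 + q l ^ 2) := by
          have := hq0 l
          gcongr
          exact two_mul_le_add_sq _ _
        _ = 4 * q l * W l + γ * (p l ^ 2 + q l ^ 2) := by ring
  have hsum : HasSum (fun l => p l ^ 2 + q l ^ 2)
      ((∑' l : ℤ, lam l ^ 2 * ‖θ t l‖ ^ 2) + ∑' l : ℤ, lam l ^ 2 * ‖G t l‖ ^ 2) := by
    simpa only [hp, hq, mul_pow] using hθ.hasSum.add hG.hasSum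
  obtain ⟨U, hUdef, hU⟩ : ∃ U : ℤ → ℝ, U = _ ∧ HasSum U _ :=
    ⟨_, rfl, hasSum_neighbour_majorant hsum (fun l => by positivity) ε δ γ k⟩
  have hform : ∀ l, 4 * p l * W l + (4 * q l * W l + γ * (p l ^ 2 + q l ^ 2)) ≤ U l := fun l => by
    have := neighbour_form_le (v := fun l => p l + q l) (e := fun l => p l ^ 2 + q l ^ 2)
      (fun l => by nlinarith [sq_nonneg (p l - q l)]) hε0 hδ0 k l
    have e : 4 * p l * W l + (4 * q l * W l + γ * (p l ^ 2 + q l ^ 2))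
        = 4 * (p l + q l) * W l + γ * (p l ^ 2 + q l ^ 2) := by ring
    rw [e, hUdef]
    exact add_le_add this le_rfl
  have n1 : ∀ l, 0 ≤ 4 * p l * W l := fun l =>
    mul_nonneg (mul_nonneg (by norm_num) (hp0 _)) (hW0 _)
  have n2 : ∀ l, 0 ≤ 4 * q l * W l + γ * (p l ^ 2 + q l ^ 2) := fun l =>
    add_nonneg (mul_nonneg (mul_nonneg (by norm_num) (hq0 _)) (hW0 _)) (by positivity)
  have s1 : Summable fun l => 4 * p l * W l :=
    Summable.of_nonneg_of_le n1 (fun l => le_trans (by linarith [n2 l]) (hform l)) hU.summable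
  have s2 : Summable fun l => 4 * q l * W l + γ * (p l ^ 2 + q l ^ 2) :=
    Summable.of_nonneg_of_le n2 (fun l => le_trans (by linarith [n1 l]) (hform l)) hU.summable
  calc _ ≤ (∑' l, 4 * p l * W l) + ∑' l, (4 * q l * W l + γ * (p l ^ 2 + q l ^ 2)) :=
        add_le_add (tsum_le_of_le_of_nonneg hdθ n1 s1) (tsum_le_of_le_of_nonneg hdG n2 s2)
    _ = ∑' l, (4 * p l * W l + (4 * q l * W l + γ * (p l ^ 2 + q l ^ 2))) :=
        (s1.tsum_add s2).symm
    _ ≤ _ := (s1.add s2).tsum_le_tsum hform hU.summable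
    _ = _ := hU.tsum_eq

/-- Growth by at most `e⁶` on each resonant interval with `π c η ≤ k³`. -/
lemma Xnorm_growth_resonant_interval {ν c η : ℝ} (hν : 0 < ν) (hc : 0 < c) (hc' : c < 0.001)
    (hη : 0 < η) {f : ℝ → ℝ} (hfb : ∀ t : ℝ, 0 ≤ t → |f t| ≤ 4 * c / (1 + t ^ 2))
    {θ G : ℝ → ℤ → ℂ} (hsol : IsWaveSol ν c η f θ G) {lam : ℤ → ℝ} (hlam : GoodWeight lam)
    (hθsum : ∀ t : ℝ, Summable fun l : ℤ => (lam l) ^ 2 * ‖θ t l‖ ^ 2)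
    (hGsum : ∀ t : ℝ, Summable fun l : ℤ => (lam l) ^ 2 * ‖G t l‖ ^ 2)
    (hθderiv : ∀ t : ℝ, HasDerivAt (fun s => ∑' l : ℤ, (lam l) ^ 2 * ‖θ s l‖ ^ 2)
        (∑' l : ℤ, (lam l) ^ 2 * deriv (fun s => ‖θ s l‖ ^ 2) t) t)
    (hGderiv : ∀ t : ℝ, HasDerivAt (fun s => ∑' l : ℤ, (lam l) ^ 2 * ‖G s l‖ ^ 2)
        (∑' l : ℤ, (lam l) ^ 2 * deriv (fun s => ‖G s l‖ ^ 2) t) t)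
    {k : ℤ} (hk : 1 ≤ k) (hk3 : Real.pi * c * η ≤ (k : ℝ) ^ 3)
    {t : ℝ} (h1 : tRes η k ≤ t) (h2 : t ≤ tRes η (k - 1)) :
    Xnorm lam (θ t) + Xnorm lam (G t)
      ≤ Real.exp 6 * (Xnorm lam (θ (tRes η k)) + Xnorm lam (G (tRes η k))) := by
  have hk' : (1 : ℝ) ≤ k := by exact_mod_cast hk
  set κ : ℝ := c * η / (k : ℝ) ^ 3 with hκ
  have hκ0 : 0 ≤ κ := by positivity
  have hκπ : κ * Real.pi ≤ 1 := by
    rw [hκ, div_mul_eq_mul_div, div_le_one (by positivity)]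
    linarith
  set r : ℝ := 16 * (20 * c * k ^ 2 / η) + k * (k + 1) / η with hr
  have hr0 : 0 ≤ r := by positivity
  set Φ : ℝ → ℝ := fun s => 6 * κ * Real.arctan (s - η / k)
    + (s - η / k) * |s - η / k| / (1 + (s - η / k) ^ 2) + r * s with hΦ
  have hΦd : ∀ s, HasDerivAt Φ (16 * (20 * c * k ^ 2 / η)
      + 6 * (κ / (1 + (s - η / (k : ℝ)) ^ 2))
      + (2 * |s - η / (k : ℝ)| / (1 + (s - η / (k : ℝ)) ^ 2) ^ 2 + k * (k + 1) / η)) s := by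
    intro s
    have hs : HasDerivAt (fun s : ℝ => s - η / k) 1 s := (hasDerivAt_id s).sub_const _
    have d1 := (hs.arctan).const_mul (6 * κ)
    have d2 := (hasDerivAt_mul_abs_div (s - η / k)).comp s hs
    have d3 := (hasDerivAt_id s).const_mul r
    refine ((d1.add d2).add d3).congr_deriv ?_
    rw [hr]
    ring
  have key := le_exp_sub_mul_of_deriv_le h1 (fun s => (hθderiv s).add (hGderiv s)) hΦd
    (fun s hs => by
      have hs0 : 0 ≤ s := le_trans (by positivity) ((div_succ_le_tRes hη hk).trans hs.1)
      exact energy_deriv_le hν hc hη hsol hlam hk hs.1 (hs.2.trans h2) (hfb s hs0)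
        (hθsum s) (hGsum s))
  have hΦdiff : Φ t - Φ (tRes η k) ≤ 11 := by
    obtain ⟨L1, L2⟩ := resonant_interval_length hη hk
    have a1 := Real.arctan_lt_pi_div_two (t - η / k)
    have a2 := Real.neg_pi_div_two_lt_arctan (tRes η k - η / k)
    have b1 := (abs_le.mp (abs_mul_abs_div_le_one (t - η / k))).2
    have b2 := (abs_le.mp (abs_mul_abs_div_le_one (tRes η k - η / k))).1
    have a3 : κ * (Real.arctan (t - η / k) - Real.arctan (tRes η k - η / k)) ≤ κ * Real.pi := by
      gcongr
      linarith
    have c1 : r * (t - tRes η k) ≤ r * (tRes η (k - 1) - tRes η k) := by gcongr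
    have c2 : r * (tRes η (k - 1) - tRes η k)
        = 320 * (c * (k ^ 2 / η * (tRes η (k - 1) - tRes η k)))
          + k * (k + 1) / η * (tRes η (k - 1) - tRes η k) := by
      rw [hr]
      ring
    have c3 : c * (k ^ 2 / η * (tRes η (k - 1) - tRes η k)) ≤ 0.001 * (4 / 3) := by
      have h0 : 0 ≤ (k : ℝ) ^ 2 / η * (tRes η (k - 1) - tRes η k) :=
        mul_nonneg (by positivity) (by linarith)
      exact mul_le_mul hc'.le L2 h0 (by norm_num)
    simp only [hΦ]
    norm_num at c3
    linarith
  have nonneg : ∀ u : ℤ → ℂ, 0 ≤ ∑' l : ℤ, lam l ^ 2 * ‖u l‖ ^ 2 := fun u =>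
    tsum_nonneg fun l => by positivity
  have hsq : ∀ u : ℤ → ℂ, Xnorm lam u ^ 2 = ∑' l : ℤ, lam l ^ 2 * ‖u l‖ ^ 2 := fun u =>
    Real.sq_sqrt (nonneg u)
  have hX0 : ∀ u : ℤ → ℂ, 0 ≤ Xnorm lam u := fun u => Real.sqrt_nonneg _
  simp only [Pi.add_apply, ← hsq] at key
  have hexp : 2 * Real.exp (Φ t - Φ (tRes η k)) ≤ Real.exp 6 ^ 2 := by
    rw [← Real.exp_nat_mul]
    have e1 : (2 : ℝ) ≤ Real.exp 1 := by linarith [Real.add_one_le_exp 1]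
    calc 2 * Real.exp (Φ t - Φ (tRes η k)) ≤ Real.exp 1 * Real.exp 11 := by gcongr
      _ = _ := by
        rw [← Real.exp_add]
        norm_num
  have hA := hX0 (θ (tRes η k))
  have hB := hX0 (G (tRes η k))
  apply le_of_sq_le_sq _ (mul_nonneg (Real.exp_pos 6).le (add_nonneg hA hB))
  calc (Xnorm lam (θ t) + Xnorm lam (G t)) ^ 2
      ≤ 2 * (Xnorm lam (θ t) ^ 2 + Xnorm lam (G t) ^ 2) := add_sq_le
    _ ≤ 2 * (Real.exp (Φ t - Φ (tRes η k))
          * (Xnorm lam (θ (tRes η k)) ^ 2 + Xnorm lam (G (tRes η k)) ^ 2)) := by gcongr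
    _ = 2 * Real.exp (Φ t - Φ (tRes η k))
          * (Xnorm lam (θ (tRes η k)) ^ 2 + Xnorm lam (G (tRes η k)) ^ 2) := by ring
    _ ≤ Real.exp 6 ^ 2 * (Xnorm lam (θ (tRes η k)) + Xnorm lam (G (tRes η k))) ^ 2 := by
        gcongr
        nlinarith
    _ = _ := by ring

lemma rpow_third_pow_three {x : ℝ} (hx : 0 ≤ x) : (x ^ ((1 : ℝ) / 3)) ^ 3 = x := by
  rw [← Real.rpow_natCast, ← Real.rpow_mul hx]
  norm_num

/-- **Growth bound in the intermediate regime.** For `η ≥ 1000`, `0 < c < 0.001` and an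
integer `k` with `(πcη)^{1/3} ≤ k ≤ (8000cηπ)^{1/3}`, on `I_k = [t_k, t_{k−1}]` the
`X`-norms grow at most by `e^{3π}`; consequently, with `k₀ = ⌊(πcη)^{1/3}⌋` and
`k₁ = ⌈(8000cηπ)^{1/3}⌉` one has
`‖θ(t_{k₀})‖_X + ‖G(t_{k₀})‖_X ≤ e^{60π(cη)^{1/3}}(‖θ(t_{k₁})‖_X + ‖G(t_{k₁})‖_X)`. -/
theorem intermediate_regime_growth
    (ν c η : ℝ) (hν : 0 < ν) (hc : 0 < c) (hc' : c < 0.001) (hη : 1000 ≤ η)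
    (f : ℝ → ℝ) (hf : Continuous f)
    (hfb : ∀ t : ℝ, 0 ≤ t → |f t| ≤ 4 * c / (1 + t ^ 2))
    (θ G : ℝ → ℤ → ℂ) (hsol : IsWaveSol ν c η f θ G)
    (lam : ℤ → ℝ) (hlam : GoodWeight lam)
    (hθsum : ∀ t : ℝ, Summable fun l : ℤ => (lam l) ^ 2 * ‖θ t l‖ ^ 2)
    (hGsum : ∀ t : ℝ, Summable fun l : ℤ => (lam l) ^ 2 * ‖G t l‖ ^ 2)
    (hθderiv : ∀ t : ℝ, HasDerivAt (fun s => ∑' l : ℤ, (lam l) ^ 2 * ‖θ s l‖ ^ 2)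
        (∑' l : ℤ, (lam l) ^ 2 * deriv (fun s => ‖θ s l‖ ^ 2) t) t)
    (hGderiv : ∀ t : ℝ, HasDerivAt (fun s => ∑' l : ℤ, (lam l) ^ 2 * ‖G s l‖ ^ 2)
        (∑' l : ℤ, (lam l) ^ 2 * deriv (fun s => ‖G s l‖ ^ 2) t) t)
    (hIPderiv : ∀ t : ℝ, HasDerivAt
        (fun s => ∑' l : ℤ, (lam l) ^ 2 * ((starRingEnd ℂ) (θ s l) * G s l).re)
        (∑' l : ℤ, (lam l) ^ 2 * deriv (fun s => ((starRingEnd ℂ) (θ s l) * G s l).re) t)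
        t) :
    (∀ k : ℤ, 1 ≤ k →
      (Real.pi * c * η) ^ ((1 : ℝ) / 3) ≤ (k : ℝ) →
      (k : ℝ) ≤ (8000 * c * η * Real.pi) ^ ((1 : ℝ) / 3) →
      ∀ t : ℝ, tRes η k ≤ t → t ≤ tRes η (k - 1) →
        Xnorm lam (θ t) + Xnorm lam (G t)
          ≤ Real.exp (3 * Real.pi)
              * (Xnorm lam (θ (tRes η k)) + Xnorm lam (G (tRes η k))))
    ∧ (∀ k₀ k₁ : ℤ,
        k₀ = ⌊(Real.pi * c * η) ^ ((1 : ℝ) / 3)⌋ →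
        k₁ = ⌈(8000 * c * η * Real.pi) ^ ((1 : ℝ) / 3)⌉ →
        1 ≤ k₀ →
        Xnorm lam (θ (tRes η k₀)) + Xnorm lam (G (tRes η k₀))
          ≤ Real.exp (60 * Real.pi * (c * η) ^ ((1 : ℝ) / 3))
              * (Xnorm lam (θ (tRes η k₁)) + Xnorm lam (G (tRes η k₁)))) := by
  have hη0 : 0 < η := by linarith
  have hpos : 0 ≤ Real.pi * c * η := by positivity
  have step : ∀ k : ℤ, 1 ≤ k → (Real.pi * c * η) ^ ((1 : ℝ) / 3) ≤ (k : ℝ) →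
      ∀ t : ℝ, tRes η k ≤ t → t ≤ tRes η (k - 1) →
        Xnorm lam (θ t) + Xnorm lam (G t)
          ≤ Real.exp 6 * (Xnorm lam (θ (tRes η k)) + Xnorm lam (G (tRes η k))) := by
    intro k hk hak t h1 h2
    refine Xnorm_growth_resonant_interval hν hc hc' hη0 hfb hsol hlam hθsum hGsum hθderiv hGderiv
      hk ?_ h1 h2
    rw [← rpow_third_pow_three hpos]
    exact pow_le_pow_left₀ (by positivity) hak 3
  have hX0 : ∀ u : ℤ → ℂ, 0 ≤ Xnorm lam u := fun u => Real.sqrt_nonneg _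
  refine ⟨fun k hk hak _ t h1 h2 => (step k hk hak t h1 h2).trans ?_, ?_⟩
  · refine mul_le_mul_of_nonneg_right (Real.exp_le_exp.mpr ?_) (add_nonneg (hX0 _) (hX0 _))
    linarith [Real.pi_gt_three]
  intro k₀ k₁ hk₀ hk₁ h1
  set a : ℝ := (Real.pi * c * η) ^ ((1 : ℝ) / 3) with ha
  have hk₀a : (k₀ : ℝ) ≤ a := hk₀ ▸ Int.floor_le a
  have hak₀ : a < k₀ + 1 := hk₀ ▸ Int.lt_floor_add_one a
  have ha1 : 1 ≤ a := le_trans (by exact_mod_cast h1) hk₀a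
  have h20 : (8000 * c * η * Real.pi) ^ ((1 : ℝ) / 3) = 20 * a := by
    rw [show 8000 * c * η * Real.pi = 20 ^ 3 * (Real.pi * c * η) by ring,
      Real.mul_rpow (by norm_num) hpos, ← Real.rpow_natCast, ← Real.rpow_mul (by norm_num)]
    norm_num
    rfl
  rw [h20] at hk₁
  have hk₁a : (k₁ : ℝ) < 20 * a + 1 := hk₁ ▸ Int.ceil_lt_add_one _
  have hak₁ : 20 * a ≤ k₁ := hk₁ ▸ Int.le_ceil _
  have iter : ∀ n : ℕ, Xnorm lam (θ (tRes η k₀)) + Xnorm lam (G (tRes η k₀)) ≤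
      Real.exp (6 * n) * (Xnorm lam (θ (tRes η (k₀ + n))) + Xnorm lam (G (tRes η (k₀ + n)))) := by
    intro n
    induction n with
    | zero => simp
    | succ n ih =>
      have hmono := tRes_le_pred hη0 (k := k₀ + n + 1) (by omega)
      have := step (k₀ + n + 1) (by omega)
        (by push_cast; linarith [(Nat.cast_nonneg n : (0 : ℝ) ≤ n)]) _ hmono le_rfl
      rw [add_sub_cancel_right] at this
      refine ih.trans ((mul_le_mul_of_nonneg_left this (Real.exp_pos _).le).trans (le_of_eq ?_))
      rw [← mul_assoc, ← Real.exp_add]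
      push_cast
      ring_nf
  have hle : k₀ ≤ k₁ := by
    have : (k₀ : ℝ) ≤ k₁ := by linarith
    exact_mod_cast this
  obtain ⟨n, hn⟩ := Int.le.dest hle
  have hnr : (k₀ : ℝ) + n = k₁ := by exact_mod_cast hn
  have := iter n
  rw [hn] at this
  refine this.trans ?_
  refine mul_le_mul_of_nonneg_right (Real.exp_le_exp.mpr ?_) (add_nonneg (hX0 _) (hX0 _))
  set x : ℝ := (c * η) ^ ((1 : ℝ) / 3) with hx
  have hx3 : x ^ 3 = c * η := rpow_third_pow_three (by positivity)
  have hx0 : 0 ≤ x := by positivity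
  have hπx : 2.1 * a ≤ Real.pi * x := by
    have hπ := Real.pi_gt_d2
    refine le_of_pow_le_pow_left₀ (n := 3) (by norm_num) (by positivity) ?_
    rw [mul_pow, mul_pow, hx3, rpow_third_pow_three hpos]
    have : (2.1 : ℝ) ^ 3 ≤ Real.pi ^ 2 := by nlinarith
    calc (2.1 : ℝ) ^ 3 * (Real.pi * c * η) ≤ Real.pi ^ 2 * (Real.pi * c * η) := by gcongr
      _ = _ := by ring
  linarith
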